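/- arXiv:2301.13731 — 2 statements merged into one kernel-verified Lean document; each statement's English description precedes it below -/
import Mathlib

section
/- Let n ≥ 1, let f : ℝⁿ → ℝ be convex, differentiable with L_f-Lipschitz gradient and bounded below, let M > 0 and let φ : ℝⁿ → ℝ be M-weakly convex and bounded below. Let λ > 0, α ∈ (0,1), and τ > 0 with τ < min(1/(α·λ·L_f), α/M). Let (q_k), (x_k), (y_k) be αPGD sequences for f, φ, λ, τ, α. Then, with F := λ·f + φ and δ := (α/(2τ))·(1 − 1/α)², the sequence E_k := F(y_k) + δ·‖y_k − y_{k−1}‖² (for k ≥ 1) is monotonically non-increasing and converges to a finite limit. -/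
open Filter Topology

open scoped RealInnerProductSpace

section Gradient

variable {E : Type*} [NormedAddCommGroup E] [InnerProductSpace ℝ E] [CompleteSpace E]

theorem HasGradientAt.hasDerivAt_comp_lineMap {f : E → ℝ} {g a b : E} {t : ℝ}
    (hf : HasGradientAt f g (a + t • (b - a))) :
    HasDerivAt (fun s : ℝ => f (a + s • (b - a))) ⟪g, b - a⟫ t := by
  have hline : HasDerivAt (fun s : ℝ => a + s • (b - a)) (b - a) t := by
    simpa using ((hasDerivAt_id t).smul_const (b - a)).const_add a
  exact hf.hasFDerivAt.comp_hasDerivAt t hline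

/-- A convex function lies above its tangent hyperplanes. -/
theorem ConvexOn.add_inner_le_of_hasGradientAt {f : E → ℝ} {g a : E}
    (hfc : ConvexOn ℝ Set.univ f) (hf : HasGradientAt f g a) (b : E) :
    f a + ⟪g, b - a⟫ ≤ f b := by
  have hconv : ConvexOn ℝ Set.univ (fun s : ℝ => f (a + s • (b - a))) := by
    have h := hfc.comp_affineMap (AffineMap.lineMap (k := ℝ) a b)
    rw [Set.preimage_univ] at h
    refine h.congr fun s _ => ?_
    simp [AffineMap.lineMap_apply, add_comm]
  have hderiv : HasDerivAt (fun s : ℝ => f (a + s • (b - a))) ⟪g, b - a⟫ 0 :=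
    HasGradientAt.hasDerivAt_comp_lineMap (by simpa using hf)
  have h := hconv.le_slope_of_hasDerivAt (Set.mem_univ 0) (Set.mem_univ 1) one_pos hderiv
  simp only [slope_def_field, one_smul, zero_smul, add_zero, add_sub_cancel, sub_zero,
    div_one] at h
  linarith

/-- The descent lemma: quadratic upper bound for functions with Lipschitz gradient. -/
theorem Differentiable.le_add_inner_gradient_add_sq {f : E → ℝ} {L : ℝ}
    (hf : Differentiable ℝ f)
    (hL : ∀ a b, ‖gradient f a - gradient f b‖ ≤ L * ‖a - b‖) (a b : E) :
    f b ≤ f a + ⟪gradient f a, b - a⟫ + L / 2 * ‖b - a‖ ^ 2 := by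
  set h : ℝ → ℝ := fun s =>
    f (a + s • (b - a)) - s * ⟪gradient f a, b - a⟫ - L / 2 * ‖b - a‖ ^ 2 * s ^ 2 with h_def
  have hderiv (s : ℝ) : HasDerivAt h (⟪gradient f (a + s • (b - a)), b - a⟫ -
      ⟪gradient f a, b - a⟫ - L * ‖b - a‖ ^ 2 * s) s := by
    have h₁ := (hf (a + s • (b - a))).hasGradientAt.hasDerivAt_comp_lineMap
    have h₂ := (hasDerivAt_id s).mul_const ⟪gradient f a, b - a⟫
    have h₃ := ((hasDerivAt_id s).pow 2).const_mul (L / 2 * ‖b - a‖ ^ 2)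
    convert! (h₁.sub h₂).sub h₃ using 1
    simp
    ring
  have hanti : AntitoneOn h (Set.Icc 0 1) := by
    refine antitoneOn_of_deriv_nonpos (convex_Icc 0 1)
      (fun s _ => (hderiv s).continuousAt.continuousWithinAt)
      (fun s _ => (hderiv s).differentiableAt.differentiableWithinAt) fun s hs => ?_
    rw [interior_Icc] at hs
    rw [(hderiv s).deriv, ← inner_sub_left]
    have hgrad := hL (a + s • (b - a)) a
    rw [add_sub_cancel_left, norm_smul, Real.norm_of_nonneg hs.1.le] at hgrad
    have hinner := real_inner_le_norm
      (gradient f (a + s • (b - a)) - gradient f a) (b - a)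
    nlinarith [mul_le_mul_of_nonneg_right hgrad (norm_nonneg (b - a))]
  have h01 := hanti (Set.left_mem_Icc.2 zero_le_one) (Set.right_mem_Icc.2 zero_le_one)
    zero_le_one
  simp only [h_def, one_smul, zero_smul, add_zero, add_sub_cancel] at h01
  linarith

end Gradient

section ProximalStep

variable {E : Type*} [NormedAddCommGroup E]

/-- Quadratic growth of a strongly convex function away from a minimizer. -/
theorem StrongConvexOn.add_sq_le_of_isMinOn [NormedSpace ℝ E] {g : E → ℝ} {s : Set E} {m : ℝ}
    {p w : E} (hg : StrongConvexOn s m g) (hmin : IsMinOn g s p) (hp : p ∈ s) (hw : w ∈ s) :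
    g p + m / 2 * ‖w - p‖ ^ 2 ≤ g w := by
  have hbound : ∀ t ∈ Set.Ioo (0 : ℝ) 1, g p + (1 - t) * (m / 2 * ‖w - p‖ ^ 2) ≤ g w := by
    intro t ht
    have ht' : 0 ≤ 1 - t := by linarith [ht.2]
    have hconv := hg.2 hw hp ht.1.le ht' (by ring)
    have hle := hmin (hg.1 hw hp ht.1.le ht' (by ring))
    simp only [Set.mem_ofPred_eq, smul_eq_mul] at hconv hle
    refine le_of_mul_le_mul_left ?_ ht.1
    linarith
  have hlim : Tendsto (fun t : ℝ => g p + (1 - t) * (m / 2 * ‖w - p‖ ^ 2)) (𝓝[>] 0)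
      (𝓝 (g p + m / 2 * ‖w - p‖ ^ 2)) := by
    have hcont : Continuous fun t : ℝ => g p + (1 - t) * (m / 2 * ‖w - p‖ ^ 2) := by fun_prop
    simpa using (hcont.tendsto 0).mono_left nhdsWithin_le_nhds
  exact le_of_tendsto hlim (Filter.mem_of_superset (Ioo_mem_nhdsGT one_pos) hbound)

variable [InnerProductSpace ℝ E]

/-- The proximal objective of an `M`-weakly convex function is strongly convex with
modulus `1 - τ * M` (which may be negative). -/
theorem StrongConvexOn.prox_objective {φ : E → ℝ} {M τ : ℝ}
    (hφ : StrongConvexOn Set.univ (-M) φ) (hτ : 0 ≤ τ) (c : E) :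
    StrongConvexOn Set.univ (1 - τ * M) (fun w => τ * φ w + (1 / 2) * ‖w - c‖ ^ 2) := by
  rw [strongConvexOn_iff_convex] at hφ ⊢
  have hlin : ConvexOn ℝ Set.univ (fun w : E => -⟪c, w⟫ + (1 / 2) * ‖c‖ ^ 2) :=
    ((-(innerSL ℝ c : E →L[ℝ] ℝ)).toLinearMap.convexOn convex_univ).add_const _
  refine ((hφ.smul hτ).add hlin).congr fun w _ => ?_
  simp only [Pi.add_apply, smul_eq_mul, norm_sub_sq_real, real_inner_comm]
  ring

/-- One proximal gradient step, relaxed by `α`, decreases `lam * f + φ` up to the energy terms;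
here `z = (1 - α) • y + α • p` is the relaxed point. -/
theorem relaxed_proxGrad_energy_le [CompleteSpace E] {f φ : E → ℝ} {Lf M lam α τ : ℝ}
    (hfc : ConvexOn ℝ Set.univ f) (hf : Differentiable ℝ f)
    (hLip : ∀ a b, ‖gradient f a - gradient f b‖ ≤ Lf * ‖a - b‖)
    (hφ : StrongConvexOn Set.univ (-M) φ)
    (hlam : 0 ≤ lam) (hα0 : 0 < α) (hα1 : α ≤ 1) (hτ : 0 < τ)
    (hτL : τ * (α * lam * Lf) ≤ 1) (hτM : τ * M ≤ α) {x y p : E}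
    (hp : IsMinOn (fun w => τ * φ w + (1 / 2) *
      ‖w - (x - (τ * lam) • gradient f ((1 - α) • y + α • x))‖ ^ 2) Set.univ p) :
    lam * f ((1 - α) • y + α • p) + φ ((1 - α) • y + α • p) +
        α / (2 * τ) * (1 - α) ^ 2 * ‖p - y‖ ^ 2 ≤
      lam * f y + φ y + α / (2 * τ) * ‖x - y‖ ^ 2 := by
  set q := (1 - α) • y + α • x with q_def
  set z := (1 - α) • y + α • p with z_def
  set G := gradient f q
  obtain ⟨u, rfl⟩ : ∃ u, x = y + u := ⟨x - y, by abel⟩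
  obtain ⟨v, rfl⟩ : ∃ v, p = y + v := ⟨p - y, by abel⟩
  have hzq : z - q = α • (v - u) := by rw [z_def, q_def]; module
  have hyq : y - q = -(α • u) := by rw [q_def]; module
  have hdescent := hf.le_add_inner_gradient_add_sq hLip q z
  have htangent := hfc.add_inner_le_of_hasGradientAt (hf q).hasGradientAt y
  have hgrowth := (hφ.prox_objective hτ.le (y + u - (τ * lam) • G)).add_sq_le_of_isMinOn hp
    (Set.mem_univ _) (Set.mem_univ y)
  have hweak := hφ.2 (Set.mem_univ y) (Set.mem_univ (y + v)) (sub_nonneg.2 hα1) hα0.le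
    (by ring)
  rw [hzq, norm_smul, mul_pow, Real.norm_of_nonneg hα0.le, inner_smul_right, inner_sub_right,
    norm_sub_sq_real] at hdescent
  rw [hyq, inner_neg_right, inner_smul_right] at htangent
  have hpc : y + v - (y + u - (τ * lam) • G) = (v - u) + (τ * lam) • G := by abel
  have hyc : y - (y + u - (τ * lam) • G) = -u + (τ * lam) • G := by abel
  have hyp : y - (y + v) = -v := by abel
  simp only [hpc, hyc, hyp, norm_add_sq_real, norm_neg, inner_neg_left, inner_sub_left,
    inner_smul_right, norm_sub_sq_real] at hgrowth
  simp only [← z_def, hyp, norm_neg, smul_eq_mul] at hweak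
  simp only [add_sub_cancel_left]
  rw [real_inner_comm G u, real_inner_comm G v] at hgrowth
  have hW : 0 ≤ α / 2 * (1 - τ * (α * lam * Lf)) * ‖v - u‖ ^ 2 := by
    have := sub_nonneg.2 hτL
    positivity
  have hV : 0 ≤ α / 2 * (2 - α) * (α - τ * M) * ‖v‖ ^ 2 := by
    have := sub_nonneg.2 hτM
    have : 0 ≤ 2 - α := by linarith
    positivity
  rw [norm_sub_sq_real] at hW
  have hr : τ * (α / (2 * τ)) = α / 2 := by field_simp
  refine le_of_mul_le_mul_left ?_ hτ
  linear_combination (τ * lam) * hdescent + (τ * lam) * htangent + α * hgrowth + τ * hweak +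
    ((1 - α) ^ 2 * ‖v‖ ^ 2 - ‖u‖ ^ 2) * hr + hW + hV

end ProximalStep

/-- The Lyapunov energy `E_k = F(y_k) + δ‖y_k - y_{k-1}‖²` (for `k ≥ 1`,
here re-indexed as `k ↦ E_{k+1}`) is non-increasing and converges along the
αPGD iterations, for `τ < min(1/(αλL_f), α/M)`. -/
theorem alphaPGD_energy_antitone_and_converges
    (n : ℕ) (hn : 1 ≤ n)
    (f φ : EuclideanSpace ℝ (Fin n) → ℝ) (Lf M lam α τ : ℝ)
    (hfc : ConvexOn ℝ Set.univ f)
    (hf : Differentiable ℝ f)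
    (hLip : ∀ a b, ‖gradient f a - gradient f b‖ ≤ Lf * ‖a - b‖)
    (hfb : BddBelow (Set.range f))
    (hM : 0 < M)
    (hφ : ConvexOn ℝ Set.univ (fun w => φ w + (M / 2) * ‖w‖ ^ 2))
    (hφb : BddBelow (Set.range φ))
    (hlam : 0 < lam) (hα0 : 0 < α) (hα1 : α < 1)
    (hτ : 0 < τ) (hτlt : τ < min (1 / (α * lam * Lf)) (α / M))
    (q x y : ℕ → EuclideanSpace ℝ (Fin n))
    (hy0 : y 0 = x 0)
    (hq : ∀ k, q (k + 1) = (1 - α) • y k + α • x k)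
    (hx : ∀ k, IsMinOn
      (fun w => τ * φ w + (1 / 2) * ‖w - (x k - (τ * lam) • gradient f (q (k + 1)))‖ ^ 2)
      Set.univ (x (k + 1)))
    (hy : ∀ k, y (k + 1) = (1 - α) • y k + α • x (k + 1)) :
    Antitone (fun k : ℕ =>
        lam * f (y (k + 1)) + φ (y (k + 1)) +
          (α / (2 * τ)) * (1 - 1 / α) ^ 2 * ‖y (k + 1) - y k‖ ^ 2) ∧
    ∃ l : ℝ, Tendsto (fun k : ℕ =>
        lam * f (y (k + 1)) + φ (y (k + 1)) +
          (α / (2 * τ)) * (1 - 1 / α) ^ 2 * ‖y (k + 1) - y k‖ ^ 2)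
      atTop (nhds l) := by
  have hLf : 0 < α * lam * Lf := by
    by_contra! h
    have := (lt_min_iff.1 hτlt).1
    linarith [div_nonpos_of_nonneg_of_nonpos zero_le_one h]
  have hτL : τ * (α * lam * Lf) ≤ 1 :=
    ((lt_div_iff₀ hLf).1 (lt_min_iff.1 hτlt).1).le
  have hτM : τ * M ≤ α := ((lt_div_iff₀ hM).1 (lt_min_iff.1 hτlt).2).le
  have hφ' : StrongConvexOn Set.univ (-M) φ := by
    rw [strongConvexOn_iff_convex]
    exact hφ.congr fun w _ => by ring
  have hδ : 0 ≤ α / (2 * τ) * (1 - 1 / α) ^ 2 := by positivity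
  have hanti : Antitone (fun k : ℕ => lam * f (y (k + 1)) + φ (y (k + 1)) +
      (α / (2 * τ)) * (1 - 1 / α) ^ 2 * ‖y (k + 1) - y k‖ ^ 2) := by
    refine antitone_nat_of_succ_le fun k => ?_
    have hmin := hx (k + 1)
    rw [hq] at hmin
    have hstep := relaxed_proxGrad_energy_le hfc hf hLip hφ' hlam.le hα0 hα1.le hτ hτL hτM hmin
    have hnew : y (k + 1 + 1) - y (k + 1) = α • (x (k + 1 + 1) - y (k + 1)) := by
      rw [hy (k + 1)]; module
    have hold : x (k + 1) - y (k + 1) = (1 / α - 1) • (y (k + 1) - y k) := by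
      have h : y (k + 1) - y k = α • (x (k + 1) - y k) := by rw [hy k]; module
      rw [h, smul_smul, sub_mul, one_div_mul_cancel hα0.ne', hy k]; module
    rw [← hy (k + 1), hold, norm_smul, mul_pow, Real.norm_eq_abs, sq_abs] at hstep
    rw [hnew, norm_smul, mul_pow, Real.norm_eq_abs, sq_abs]
    have hcoef : (1 - 1 / α) ^ 2 * α ^ 2 = (1 - α) ^ 2 := by field_simp; ring
    linear_combination hstep + α / (2 * τ) * ‖x (k + 1 + 1) - y (k + 1)‖ ^ 2 * hcoef
  refine ⟨hanti, _, tendsto_atTop_ciInf hanti ?_⟩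
  obtain ⟨bf, hbf⟩ := hfb
  obtain ⟨bφ, hbφ⟩ := hφb
  refine ⟨lam * bf + bφ, ?_⟩
  rintro _ ⟨k, rfl⟩
  have h₁ := mul_le_mul_of_nonneg_left (hbf (Set.mem_range_self (y (k + 1)))) hlam.le
  have h₂ := hbφ (Set.mem_range_self (y (k + 1)))
  have h₃ := mul_nonneg hδ (sq_nonneg ‖y (k + 1) - y k‖)
  dsimp only
  linarith
end

section
/- Let n ≥ 1, let f : ℝⁿ → ℝ be convex, differentiable with L_f-Lipschitz gradient and bounded below, let M > 0 and let φ : ℝⁿ → ℝ be M-weakly convex and bounded below. Let λ > 0, α ∈ (0,1), τ > 0 with τ < min(1/(α·λ·L_f), α/M). Let (q_k), (x_k), (y_k) be αPGD sequences for f, φ, λ, τ, α. Then every cluster point y of the sequence (y_k) is a stationary point of F := λ·f + φ, in the following sense: for all x ∈ ℝⁿ, φ(x) + (M/2)‖x‖² ≥ φ(y) + (M/2)‖y‖² + ⟨M·y − λ·∇f(y), x − y⟩ (i.e. M·y − λ·∇f(y) is a subgradient at y of the convex function φ + (M/2)‖·‖², equivalently −λ·∇f(y) ∈ ∂φ(y)).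 -/
open Filter Topology
open scoped RealInnerProductSpace

section AlphaPGD

variable {E : Type*} [NormedAddCommGroup E] [InnerProductSpace ℝ E]

/-- The defect of convexity of the squared norm along a segment. -/
lemma norm_sq_one_sub_smul_add_smul (a b : E) (t : ℝ) :
    ‖(1 - t) • a + t • b‖ ^ 2 =
      (1 - t) * ‖a‖ ^ 2 + t * ‖b‖ ^ 2 - t * (1 - t) * ‖a - b‖ ^ 2 := by
  rw [norm_add_sq_real, norm_sub_sq_real, norm_smul, norm_smul, mul_pow, mul_pow,
    Real.norm_eq_abs, Real.norm_eq_abs, sq_abs, sq_abs, real_inner_smul_left,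
    real_inner_smul_right]
  ring

/-- The convexity inequality for weakly convex functions. -/
lemma weaklyConvex_segment_le {φ : E → ℝ} {M : ℝ}
    (hφ : ConvexOn ℝ Set.univ (fun w => φ w + (M / 2) * ‖w‖ ^ 2))
    (a b : E) {t : ℝ} (ht0 : 0 ≤ t) (ht1 : t ≤ 1) :
    φ ((1 - t) • a + t • b) ≤
      (1 - t) * φ a + t * φ b + (M / 2) * (t * (1 - t)) * ‖a - b‖ ^ 2 := by
  have h := hφ.2 (Set.mem_univ a) (Set.mem_univ b) (sub_nonneg.2 ht1) ht0 (by ring)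
  simp only [norm_sq_one_sub_smul_add_smul, smul_eq_mul] at h
  linarith

/-- Quadratic growth of the proximal objective of a weakly convex function at a minimizer. -/
lemma weaklyConvex_prox_growth {φ : E → ℝ} {M τ : ℝ} (hτ : 0 < τ)
    (hφ : ConvexOn ℝ Set.univ (fun w => φ w + (M / 2) * ‖w‖ ^ 2)) {c p : E}
    (hp : IsMinOn (fun w => τ * φ w + (1 / 2) * ‖w - c‖ ^ 2) Set.univ p) (w : E) :
    τ * φ p + (1 / 2) * ‖p - c‖ ^ 2 + (1 - τ * M) / 2 * ‖w - p‖ ^ 2 ≤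
      τ * φ w + (1 / 2) * ‖w - c‖ ^ 2 := by
  have key : ∀ t ∈ Set.Ioo (0 : ℝ) 1,
      τ * φ p + (1 / 2) * ‖p - c‖ ^ 2 + (1 - t) * ((1 - τ * M) / 2 * ‖w - p‖ ^ 2) ≤
        τ * φ w + (1 / 2) * ‖w - c‖ ^ 2 := by
    rintro t ⟨ht0, ht1⟩
    have hmin := isMinOn_iff.1 hp ((1 - t) • p + t • w) (Set.mem_univ _)
    have hφt := mul_le_mul_of_nonneg_left
      (weaklyConvex_segment_le hφ p w ht0.le ht1.le) hτ.le
    have hc : (1 - t) • p + t • w - c = (1 - t) • (p - c) + t • (w - c) := by module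
    rw [hc, norm_sq_one_sub_smul_add_smul, sub_sub_sub_cancel_right] at hmin
    rw [norm_sub_rev w p]
    refine le_of_mul_le_mul_left ?_ ht0
    linarith
  have hlim : Tendsto (fun t : ℝ => τ * φ p + (1 / 2) * ‖p - c‖ ^ 2 +
      (1 - t) * ((1 - τ * M) / 2 * ‖w - p‖ ^ 2)) (𝓝[>] 0)
      (𝓝 (τ * φ p + (1 / 2) * ‖p - c‖ ^ 2 +
        (1 - 0) * ((1 - τ * M) / 2 * ‖w - p‖ ^ 2))) :=
    (Continuous.tendsto (by fun_prop) 0).mono_left nhdsWithin_le_nhds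
  have := le_of_tendsto hlim (eventually_of_mem (Ioo_mem_nhdsGT one_pos) key)
  linarith

/-- The three-point inequality for a proximal gradient step with a weakly convex function. -/
lemma weaklyConvex_proxGrad_three_point {φ : E → ℝ} {M τ lam : ℝ} (hτ : 0 < τ)
    (hφ : ConvexOn ℝ Set.univ (fun w => φ w + (M / 2) * ‖w‖ ^ 2)) {x g p : E}
    (hp : IsMinOn (fun w => τ * φ w + (1 / 2) * ‖w - (x - (τ * lam) • g)‖ ^ 2)
      Set.univ p) (w : E) :
    τ * φ p + (1 / 2) * ‖p - x‖ ^ 2 + (1 - τ * M) / 2 * ‖w - p‖ ^ 2 ≤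
      τ * φ w + (1 / 2) * ‖w - x‖ ^ 2 + τ * lam * ⟪g, w - p⟫ := by
  have h := weaklyConvex_prox_growth hτ hφ hp w
  have hexp : ∀ v : E, ‖v - (x - (τ * lam) • g)‖ ^ 2 =
      ‖v - x‖ ^ 2 + 2 * (τ * lam) * ⟪g, v - x⟫ + ‖(τ * lam) • g‖ ^ 2 := by
    intro v
    rw [← sub_add, norm_add_sq_real, real_inner_smul_right, real_inner_comm]
    ring
  have hin : ⟪g, w - p⟫ = ⟪g, w - x⟫ - ⟪g, p - x⟫ := by
    rw [← inner_sub_right, sub_sub_sub_cancel_right]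
  rw [hexp, hexp] at h
  rw [hin]
  linarith

variable [CompleteSpace E]

lemma hasDerivAt_comp_add_smul {f : E → ℝ} (hf : Differentiable ℝ f) (a v : E) (t : ℝ) :
    HasDerivAt (fun s : ℝ => f (a + s • v)) ⟪gradient f (a + t • v), v⟫ t := by
  have hline : HasDerivAt (fun s : ℝ => a + s • v) v t := by
    simpa using ((hasDerivAt_id t).smul_const v).const_add a
  have h := (hf (a + t • v)).hasGradientAt.hasFDerivAt.comp_hasDerivAt t hline
  rw [InnerProductSpace.toDual_apply_apply] at h
  exact h

/-- The gradient inequality for differentiable convex functions. -/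
lemma ConvexOn.add_inner_gradient_le {f : E → ℝ} (hfc : ConvexOn ℝ Set.univ f)
    (hf : Differentiable ℝ f) (a b : E) :
    f a + ⟪gradient f a, b - a⟫ ≤ f b := by
  have hc : ConvexOn ℝ Set.univ (fun s : ℝ => f (a + s • (b - a))) := by
    have h := hfc.comp_affineMap (AffineMap.lineMap (k := ℝ) a b)
    rw [Set.preimage_univ] at h
    refine h.congr fun s _ => ?_
    simp [AffineMap.lineMap_apply, add_comm]
  have hd := hasDerivAt_comp_add_smul hf a (b - a) 0
  have h := hc.le_slope_of_hasDerivAt (Set.mem_univ 0) (Set.mem_univ 1) one_pos hd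
  simp only [slope_def_field, zero_smul, one_smul, add_zero, add_sub_cancel, sub_zero,
    div_one] at h
  linarith

/-- The descent lemma for functions with Lipschitz gradient. -/
lemma le_add_inner_gradient_of_lipschitz {f : E → ℝ} {L : ℝ} (hf : Differentiable ℝ f)
    (hLip : ∀ a b, ‖gradient f a - gradient f b‖ ≤ L * ‖a - b‖) (a b : E) :
    f b ≤ f a + ⟪gradient f a, b - a⟫ + L / 2 * ‖b - a‖ ^ 2 := by
  set v := b - a with hv
  have hd : ∀ t : ℝ, HasDerivAt
      (fun s : ℝ => f (a + s • v) - s * ⟪gradient f a, v⟫ - s ^ 2 * (L / 2 * ‖v‖ ^ 2))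
      (⟪gradient f (a + t • v), v⟫ - ⟪gradient f a, v⟫ - t * (L * ‖v‖ ^ 2)) t := by
    intro t
    have h := ((hasDerivAt_comp_add_smul hf a v t).sub
      ((hasDerivAt_id t).mul_const ⟪gradient f a, v⟫)).sub
      ((hasDerivAt_pow 2 t).mul_const (L / 2 * ‖v‖ ^ 2))
    refine h.congr_deriv ?_
    simp
    ring
  have hanti := antitoneOn_of_hasDerivWithinAt_nonpos (convex_Icc (0 : ℝ) 1)
    (fun t _ => (hd t).continuousAt.continuousWithinAt)
    (fun t _ => (hd t).hasDerivWithinAt) (by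
      intro t ht
      rw [interior_Icc] at ht
      have hb : ‖gradient f (a + t • v) - gradient f a‖ ≤ L * (t * ‖v‖) := by
        simpa [norm_smul, abs_of_pos ht.1] using hLip (a + t • v) a
      have hcs := real_inner_le_norm (gradient f (a + t • v) - gradient f a) v
      rw [inner_sub_left] at hcs
      have := mul_le_mul_of_nonneg_right hb (norm_nonneg v)
      linarith)
  have h := hanti (Set.left_mem_Icc.2 zero_le_one) (Set.right_mem_Icc.2 zero_le_one)
    zero_le_one
  have hb : a + v = b := by simp [hv]
  simp only [hb, zero_smul, one_smul, add_zero] at h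
  linarith

/-- One αPGD step decreases the Lyapunov function `τ (λ f + φ) (y) + (α / 2) ‖y - x‖²`. -/
lemma alphaPGD_lyapunov_step {f φ : E → ℝ} {L M lam α τ : ℝ}
    (hfc : ConvexOn ℝ Set.univ f) (hf : Differentiable ℝ f)
    (hLip : ∀ a b, ‖gradient f a - gradient f b‖ ≤ L * ‖a - b‖)
    (hφ : ConvexOn ℝ Set.univ (fun w => φ w + (M / 2) * ‖w‖ ^ 2))
    (hlam : 0 < lam) (hα0 : 0 < α) (hα1 : α < 1) (hτ : 0 < τ)
    {x y q x' y' : E} (hq : q = (1 - α) • y + α • x)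
    (hx : IsMinOn (fun w => τ * φ w + (1 / 2) * ‖w - (x - (τ * lam) • gradient f q)‖ ^ 2)
      Set.univ x')
    (hy : y' = (1 - α) • y + α • x') :
    τ * (lam * f y' + φ y') + α / 2 * ‖y' - x'‖ ^ 2
        + (α / 2 * ((2 - α) * (α - τ * M)) * ‖y - x'‖ ^ 2
          + α / 2 * (1 - α * lam * L * τ) * ‖x' - x‖ ^ 2) ≤
      τ * (lam * f y + φ y) + α / 2 * ‖y - x‖ ^ 2 := by
  have hdesc := le_add_inner_gradient_of_lipschitz hf hLip q y'
  have hgrad := hfc.add_inner_gradient_le hf q y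
  have hwc := weaklyConvex_segment_le hφ y x' hα0.le hα1.le
  have hprox := weaklyConvex_proxGrad_three_point hτ hφ hx y
  have hyq : y' - q = α • (x' - x) := by rw [hy, hq]; module
  have hyx : y' - x' = (1 - α) • (y - x') := by rw [hy]; module
  have hin : ⟪gradient f q, y - q⟫ =
      ⟪gradient f q, y' - q⟫ + α * ⟪gradient f q, y - x'⟫ := by
    rw [← real_inner_smul_right, ← inner_add_right, hy]
    congr 1
    module
  have hn1 : ‖y' - q‖ ^ 2 = α ^ 2 * ‖x' - x‖ ^ 2 := by
    rw [hyq, norm_smul, mul_pow, Real.norm_eq_abs, sq_abs]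
  have hn2 : ‖y' - x'‖ ^ 2 = (1 - α) ^ 2 * ‖y - x'‖ ^ 2 := by
    rw [hyx, norm_smul, mul_pow, Real.norm_eq_abs, sq_abs]
  rw [← hy] at hwc
  rw [hn1] at hdesc
  rw [hin] at hgrad
  rw [hn2]
  have h1 := mul_le_mul_of_nonneg_left (hdesc.trans (by linarith :
    _ ≤ f y - α * ⟪gradient f q, y - x'⟫ + L / 2 * (α ^ 2 * ‖x' - x‖ ^ 2)))
    (mul_pos hτ hlam).le
  have h2 := mul_le_mul_of_nonneg_left hwc hτ.le
  have h3 := mul_le_mul_of_nonneg_left hprox hα0.le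
  linarith

end AlphaPGD

/-- If the decrements of a sequence bounded below dominate a nonnegative sequence, the latter
tends to zero. -/
lemma tendsto_zero_of_add_le_of_bounded {V d : ℕ → ℝ} {B : ℝ} (hB : ∀ k, B ≤ V k)
    (hd : ∀ k, 0 ≤ d k) (hV : ∀ k, V (k + 1) + d k ≤ V k) : Tendsto d atTop (𝓝 0) := by
  refine (summable_of_sum_range_le (c := V 0 - B) hd fun m => ?_).tendsto_atTop_zero
  have h : ∑ i ∈ Finset.range m, d i ≤ V 0 - V m := by
    rw [← Finset.sum_range_sub']
    exact Finset.sum_le_sum fun i _ => by linarith [hV i]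
  linarith [hB m]

/-- If `c ‖v k‖²` is dominated by a null sequence for some `c > 0`, then `v` tends to zero. -/
lemma tendsto_zero_of_mul_norm_sq_le {E : Type*} [NormedAddCommGroup E] {v : ℕ → E}
    {d : ℕ → ℝ} {c : ℝ} (hc : 0 < c) (hd : Tendsto d atTop (𝓝 0))
    (h : ∀ k, c * ‖v k‖ ^ 2 ≤ d k) : Tendsto v atTop (𝓝 0) := by
  have h1 : Tendsto (fun k => c * ‖v k‖ ^ 2) atTop (𝓝 0) :=
    squeeze_zero (fun k => by positivity) h hd
  have h2 : Tendsto (fun k => √(c⁻¹ * (c * ‖v k‖ ^ 2))) atTop (𝓝 √(c⁻¹ * 0)) :=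
    (h1.const_mul c⁻¹).sqrt
  rw [tendsto_zero_iff_norm_tendsto_zero]
  simpa [inv_mul_cancel_left₀ hc.ne'] using h2

/-- Every cluster point of the sequence `(y_k)` produced by the αPGD
algorithm is a stationary point of `F = λ f + φ`, in the sense that
`-λ ∇f(y) ∈ ∂φ(y)`, i.e. `M y - λ ∇f(y)` is a subgradient at `y` of the
convex function `φ + (M/2)‖·‖²`. -/
theorem alphaPGD_cluster_points_stationary
    (n : ℕ) (hn : 1 ≤ n)
    (f φ : EuclideanSpace ℝ (Fin n) → ℝ) (Lf M lam α τ : ℝ)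
    (hfc : ConvexOn ℝ Set.univ f)
    (hf : Differentiable ℝ f)
    (hLip : ∀ a b, ‖gradient f a - gradient f b‖ ≤ Lf * ‖a - b‖)
    (hfb : BddBelow (Set.range f))
    (hM : 0 < M)
    (hφ : ConvexOn ℝ Set.univ (fun w => φ w + (M / 2) * ‖w‖ ^ 2))
    (hφb : BddBelow (Set.range φ))
    (hlam : 0 < lam) (hα0 : 0 < α) (hα1 : α < 1)
    (hτ : 0 < τ) (hτlt : τ < min (1 / (α * lam * Lf)) (α / M))
    (q x y : ℕ → EuclideanSpace ℝ (Fin n))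
    (hy0 : y 0 = x 0)
    (hq : ∀ k, q (k + 1) = (1 - α) • y k + α • x k)
    (hx : ∀ k, IsMinOn
      (fun w => τ * φ w + (1 / 2) * ‖w - (x k - (τ * lam) • gradient f (q (k + 1)))‖ ^ 2)
      Set.univ (x (k + 1)))
    (hy : ∀ k, y (k + 1) = (1 - α) • y k + α • x (k + 1))
    (z : EuclideanSpace ℝ (Fin n))
    (hz : ∃ k : ℕ → ℕ, Tendsto k atTop atTop ∧
      Tendsto (fun i => y (k i)) atTop (nhds z)) :
    ∀ u : EuclideanSpace ℝ (Fin n),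
      φ u + (M / 2) * ‖u‖ ^ 2 ≥
        φ z + (M / 2) * ‖z‖ ^ 2 + ⟪M • z - lam • gradient f z, u - z⟫ := by
  obtain ⟨hτ1, hτM⟩ := lt_min_iff.1 hτlt
  have hLf : 0 < α * lam * Lf := one_div_pos.1 (hτ.trans hτ1)
  rw [lt_div_iff₀ hLf] at hτ1
  rw [lt_div_iff₀ hM] at hτM
  obtain ⟨Bf, hBf⟩ := hfb
  obtain ⟨Bφ, hBφ⟩ := hφb
  have hc1 : 0 < α / 2 * ((2 - α) * (α - τ * M)) :=
    mul_pos (half_pos hα0) (mul_pos (by linarith) (by linarith))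
  have hc2 : 0 < α / 2 * (1 - α * lam * Lf * τ) := mul_pos (half_pos hα0) (by linarith)
  have hdecr := tendsto_zero_of_add_le_of_bounded (B := τ * (lam * Bf + Bφ))
    (V := fun k => τ * (lam * f (y k) + φ (y k)) + α / 2 * ‖y k - x k‖ ^ 2)
    (fun k => by
      have h1 : Bf ≤ f (y k) := hBf ⟨_, rfl⟩
      have h2 : Bφ ≤ φ (y k) := hBφ ⟨_, rfl⟩
      have h3 : τ * (lam * Bf + Bφ) ≤ τ * (lam * f (y k) + φ (y k)) := by gcongr
      have h4 : 0 ≤ α / 2 * ‖y k - x k‖ ^ 2 := by positivity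
      linarith)
    (fun k => by positivity)
    (fun k => alphaPGD_lyapunov_step hfc hf hLip hφ hlam hα0 hα1 hτ (hq k) (hx k) (hy k))
  have hyx : Tendsto (fun k => y k - x (k + 1)) atTop (𝓝 0) :=
    tendsto_zero_of_mul_norm_sq_le hc1 hdecr fun k => le_add_of_nonneg_right (by positivity)
  have hxx : Tendsto (fun k => x (k + 1) - x k) atTop (𝓝 0) :=
    tendsto_zero_of_mul_norm_sq_le hc2 hdecr fun k => le_add_of_nonneg_left (by positivity)
  obtain ⟨k, hk, hyz⟩ := hz
  have hx'z : Tendsto (fun i => x (k i + 1)) atTop (𝓝 z) := by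
    simpa using hyz.sub (hyx.comp hk)
  have hxz : Tendsto (fun i => x (k i)) atTop (𝓝 z) := by
    simpa using hx'z.sub (hxx.comp hk)
  have hqz : Tendsto (fun i => q (k i + 1)) atTop (𝓝 z) := by
    have h := (hyz.const_smul (1 - α)).add (hxz.const_smul α)
    rw [← add_smul, sub_add_cancel, one_smul] at h
    simpa only [hq] using h
  have hgc : Continuous (gradient f) :=
    (LipschitzWith.of_dist_le_mul (K := Lf.toNNReal) fun a b => by
      rw [dist_eq_norm, dist_eq_norm]
      exact (hLip a b).trans (by gcongr; exact Real.le_coe_toNNReal Lf)).continuous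
  have hφc : Continuous φ := by
    have h := continuousOn_univ.1 (hφ.continuousOn isOpen_univ)
    have hs : Continuous fun w : EuclideanSpace ℝ (Fin n) => (M / 2) * ‖w‖ ^ 2 := by fun_prop
    exact (h.sub hs).congr fun w => add_sub_cancel_right _ _
  intro u
  have hgz := (hgc.tendsto z).comp hqz
  have hlim := le_of_tendsto_of_tendsto'
    (((((hφc.tendsto z).comp hx'z).const_mul τ).add
      (((hx'z.sub hxz).norm.pow 2).const_mul (1 / 2))).add
      (((hx'z.const_sub u).norm.pow 2).const_mul ((1 - τ * M) / 2)))
    (((((hxz.const_sub u).norm.pow 2).const_mul (1 / 2)).const_add (τ * φ u)).add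
      ((hgz.inner (hx'z.const_sub u)).const_mul (τ * lam)))
    (fun i => weaklyConvex_proxGrad_three_point hτ hφ (hx (k i)) u)
  rw [sub_self, norm_zero] at hlim
  have hτineq : τ * φ z ≤ τ * (φ u + M / 2 * ‖u - z‖ ^ 2 + lam * ⟪gradient f z, u - z⟫) := by
    linarith
  have hineq := le_of_mul_le_mul_left hτineq hτ
  have hsq : ‖u - z‖ ^ 2 = ‖u‖ ^ 2 - ‖z‖ ^ 2 - 2 * ⟪z, u - z⟫ := by
    rw [norm_sub_sq_real, inner_sub_right, real_inner_self_eq_norm_sq, real_inner_comm]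
    ring
  rw [hsq] at hineq
  rw [inner_sub_left, real_inner_smul_left, real_inner_smul_left]
  linarith
end
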